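/- Let w₁, w₂ ∈ ℂ be such that w₁ ∉ Λ, w₂ ∉ Λ and w₁ + w₂ ∉ Λ. Then for all t, s, u ∈ ℂ with t − u ∉ Λ, s − t ∉ Λ and s − u ∉ Λ, one has the three-term identity σ_{w₁+w₂}(t−u)·σ_{w₂}(s−t) − σ_{w₂}(s−u)·σ_{w₁}(t−u) + σ_{w₁}(t−s)·σ_{w₁+w₂}(s−u) = 0. -/

import Mathlib

open Complex Filter
open scoped Topology

noncomputable section

/-- The lattice `Λ = ℤτ + ℤ ⊂ ℂ` as a set. -/
def Lam (τ : ℂ) : Set ℂ := {c | ∃ l m : ℤ, c = l * τ + m}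

/-- The infinite product `(y;q) = ∏_{j=0}^∞ (1 - y qʲ)`. -/
def qPoch (y q : ℂ) : ℂ := ∏' j : ℕ, (1 - y * q ^ j)

/-- The first Jacobi theta function
`θ(z,τ) = i e^{πi(τ/4 - z)} (x;q)(q/x;q)(q;q)`, `q = e^{2πiτ}`, `x = e^{2πiz}`. -/
def theta (z τ : ℂ) : ℂ :=
  Complex.I * Complex.exp ((Real.pi : ℂ) * Complex.I * (τ / 4 - z)) *
    qPoch (Complex.exp (2 * (Real.pi : ℂ) * Complex.I * z))
      (Complex.exp (2 * (Real.pi : ℂ) * Complex.I * τ)) *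
    qPoch (Complex.exp (2 * (Real.pi : ℂ) * Complex.I * τ) /
        Complex.exp (2 * (Real.pi : ℂ) * Complex.I * z))
      (Complex.exp (2 * (Real.pi : ℂ) * Complex.I * τ)) *
    qPoch (Complex.exp (2 * (Real.pi : ℂ) * Complex.I * τ))
      (Complex.exp (2 * (Real.pi : ℂ) * Complex.I * τ))

/-- `θ'(z,τ)`, the derivative of `θ` in the `z` variable. -/
def thetaD (z τ : ℂ) : ℂ := deriv (fun u => theta u τ) z

/-- `σ_w(t,τ) = θ(w-t,τ)θ'(0,τ)/(θ(w,τ)θ(t,τ))`. -/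
def sigmaW (w t τ : ℂ) : ℂ := theta (w - t) τ * thetaD 0 τ / (theta w τ * theta t τ)


lemma differentiable_qPoch {q : ℂ} (hq : ‖q‖ < 1) : Differentiable ℂ (fun y => qPoch y q) := by
  intro y
  have hu : Summable fun n : ℕ => (‖y‖ + 1) * ‖q‖ ^ n :=
    (summable_geometric_of_lt_one (norm_nonneg _) hq).mul_left _
  have h := hu.hasProdLocallyUniformlyOn_nat_one_add
    (f := fun (n : ℕ) (z : ℂ) => -(z * q ^ n)) (K := Metric.ball 0 (‖y‖ + 1)) Metric.isOpen_ball
    (.of_forall fun n z hz => by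
      have : ‖z‖ ≤ ‖y‖ + 1 := by simpa using (Metric.mem_ball.1 hz).le
      rw [norm_neg, norm_mul, norm_pow]
      gcongr) (fun n => by fun_prop)
  have hd := h.differentiableOn (.of_forall fun _ => by
    simpa [Finset.prod_fn] using DifferentiableOn.finsetProd (fun _ _ => by fun_prop))
    Metric.isOpen_ball
  have := hd.differentiableAt (Metric.isOpen_ball.mem_nhds (show y ∈ _ by simp))
  simpa only [qPoch, sub_eq_add_neg] using this

lemma summable_norm_mul_pow {q : ℂ} (hq : ‖q‖ < 1) (y : ℂ) :
    Summable fun n : ℕ => ‖-(y * q ^ n)‖ := by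
  simpa using (summable_geometric_of_lt_one (norm_nonneg _) hq).mul_left ‖y‖

lemma qPoch_eq_mul {q : ℂ} (hq : ‖q‖ < 1) (y : ℂ) :
    qPoch y q = (1 - y) * qPoch (y * q) q := by
  have h : Multipliable fun n : ℕ => 1 + -(y * q ^ (n + 1)) :=
    multipliable_one_add_of_summable (by
      simpa [pow_succ', mul_assoc] using summable_norm_mul_pow hq (y * q))
  have := tprod_eq_zero_mul' (f := fun n : ℕ => 1 + -(y * q ^ n)) h
  simpa only [qPoch, sub_eq_add_neg, pow_zero, mul_one, pow_succ', mul_assoc] using this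

lemma qPoch_ne_zero {q : ℂ} (hq : ‖q‖ < 1) {y : ℂ} (hy : ∀ n : ℕ, y * q ^ n ≠ 1) :
    qPoch y q ≠ 0 := by
  have := tprod_one_add_ne_zero_of_summable (f := fun n : ℕ => -(y * q ^ n))
    (fun n => by simpa [← sub_eq_add_neg, sub_eq_zero] using (hy n).symm)
    (summable_norm_mul_pow hq y)
  simpa only [qPoch, sub_eq_add_neg] using this

/-- The multiplicative theta function `(x;q)(q/x;q)`. -/
def mulTheta (q x : ℂ) : ℂ := qPoch x q * qPoch (q / x) q

section mulTheta

variable {q : ℂ}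

lemma mulTheta_one (hq : ‖q‖ < 1) : mulTheta q 1 = 0 := by
  simp [mulTheta, qPoch_eq_mul hq 1]

lemma mulTheta_q_mul (hq : ‖q‖ < 1) (hq0 : q ≠ 0) {x : ℂ} (hx : x ≠ 0) :
    mulTheta q (q * x) = -(mulTheta q x / x) := by
  have h : q / (q * x) = x⁻¹ := by field_simp
  rw [mulTheta, mulTheta, h, qPoch_eq_mul hq x, qPoch_eq_mul hq x⁻¹, mul_comm x q,
    inv_mul_eq_div]
  field_simp
  ring

lemma mulTheta_inv (hq : ‖q‖ < 1) {x : ℂ} (hx : x ≠ 0) :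
    mulTheta q x⁻¹ = -(mulTheta q x / x) := by
  rw [mulTheta, mulTheta, qPoch_eq_mul hq x, qPoch_eq_mul hq x⁻¹, inv_mul_eq_div, div_inv_eq_mul,
    mul_comm q x]
  field_simp
  ring

lemma mulTheta_div_q_mul (hq : ‖q‖ < 1) (hq0 : q ≠ 0) {a x : ℂ} (ha : a ≠ 0) (hx : x ≠ 0) :
    mulTheta q (a / (q * x)) = -(a / (q * x) * mulTheta q (a / x)) := by
  have h := mulTheta_q_mul hq hq0 (x := a / (q * x)) (by positivity)
  rw [show q * (a / (q * x)) = a / x by field_simp] at h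
  rw [h]
  field_simp

lemma mulTheta_ne_zero (hq : ‖q‖ < 1) (hq0 : q ≠ 0) {x : ℂ} (hx : x ≠ 0)
    (h : ∀ n : ℤ, x ≠ q ^ n) : mulTheta q x ≠ 0 := by
  refine mul_ne_zero (qPoch_ne_zero hq fun n hn => h (-n) ?_)
    (qPoch_ne_zero hq fun n hn => h (n + 1) ?_)
  · rw [zpow_neg, zpow_natCast]
    exact eq_inv_of_mul_eq_one_left hn
  · rw [zpow_add₀ hq0, zpow_natCast, zpow_one]
    field_simp at hn
    rw [← hn]
    ring

lemma differentiableAt_mulTheta (hq : ‖q‖ < 1) {x : ℂ} (hx : x ≠ 0) :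
    DifferentiableAt ℂ (mulTheta q) x :=
  (differentiable_qPoch hq x).mul
    (DifferentiableAt.fun_comp' x (differentiable_qPoch hq (q / x))
      ((differentiableAt_const q).div differentiableAt_id hx))

lemma differentiableAt_mulTheta_mul (hq : ‖q‖ < 1) {a x : ℂ} (ha : a ≠ 0) (hx : x ≠ 0) :
    DifferentiableAt ℂ (fun x => mulTheta q (x * a)) x :=
  DifferentiableAt.fun_comp' x (differentiableAt_mulTheta hq (mul_ne_zero hx ha)) (by fun_prop)

lemma differentiableAt_mulTheta_div (hq : ‖q‖ < 1) {a x : ℂ} (ha : a ≠ 0) (hx : x ≠ 0) :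
    DifferentiableAt ℂ (fun x => mulTheta q (a / x)) x :=
  DifferentiableAt.fun_comp' x (differentiableAt_mulTheta hq (div_ne_zero ha hx))
    ((differentiableAt_const a).div differentiableAt_id hx)

end mulTheta

/-- The circle average of a function holomorphic on `ℂ \ {0}` does not depend on the radius. -/
lemma circleAverage_comp_mul {g : ℂ → ℂ} (hg : ∀ z ≠ 0, DifferentiableAt ℂ g z) {ρ : ℂ}
    (hρ : ρ ≠ 0) :
    Real.circleAverage (fun z => g (ρ * z)) 0 1 = Real.circleAverage g 0 1 := by
  have key : ∀ r R : ℝ, 0 < r → r ≤ R →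
      Real.circleAverage g 0 R = Real.circleAverage g 0 r := by
    intro r R hr hrR
    rw [Real.circleAverage_eq_circleIntegral hr.ne',
      Real.circleAverage_eq_circleIntegral (hr.trans_le hrR).ne']
    congr 1
    have hd : ∀ z : ℂ, z ≠ 0 → DifferentiableAt ℂ (fun z => (z - 0)⁻¹ • g z) z := fun z hz => by
      have := hg z hz
      simp only [sub_zero, smul_eq_mul]
      exact (differentiableAt_id.inv hz).mul this
    refine circleIntegral_eq_of_differentiable_on_annulus_off_countable hr hrR
      Set.countable_empty (fun z hz => (hd z ?_).continuousAt.continuousWithinAt)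
      (fun z hz => hd z ?_)
    · rintro rfl
      simp [hr] at hz
    · rintro rfl
      simp [hr.le] at hz
  have hn : 0 < ‖ρ‖ := norm_pos_iff.2 hρ
  have h1 : Real.circleAverage g 0 ‖ρ‖ = Real.circleAverage g 0 1 := by
    rcases le_total ‖ρ‖ 1 with h | h
    · exact (key _ _ hn h).symm
    · exact key _ _ one_pos h
  rw [← h1, Real.circleAverage_eq_integral_add (f := g) (arg ρ), Real.circleAverage_def]
  congr 2
  ext θ
  congr 1
  conv_lhs => rw [← norm_mul_exp_arg_mul_I ρ]
  simp only [circleMap, zero_add, ofReal_one, one_mul, mul_assoc, ← Complex.exp_add]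
  push_cast
  ring_nf

/-- The `n`-th Laurent coefficient at `0` of a function holomorphic on `ℂ \ {0}`. -/
def laurentCoeff (F : ℂ → ℂ) (n : ℤ) : ℂ := Real.circleAverage (fun z => z ^ (-n) * F z) 0 1

section laurentCoeff

variable {F : ℂ → ℂ}

lemma differentiableAt_zpow_mul (hF : ∀ z ≠ 0, DifferentiableAt ℂ F z) (n : ℤ) {z : ℂ}
    (hz : z ≠ 0) : DifferentiableAt ℂ (fun z => z ^ n * F z) z :=
  (differentiableAt_zpow.2 (.inl hz)).mul (hF z hz)

lemma laurentCoeff_comp_mul (hF : ∀ z ≠ 0, DifferentiableAt ℂ F z) {ρ : ℂ} (hρ : ρ ≠ 0) (n : ℤ) :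
    laurentCoeff (fun z => F (ρ * z)) n = ρ ^ n * laurentCoeff F n := by
  rw [laurentCoeff, laurentCoeff,
    ← circleAverage_comp_mul (fun z hz => differentiableAt_zpow_mul hF (-n) hz) hρ,
    ← smul_eq_mul (ρ ^ n), ← Real.circleAverage_fun_smul]
  congr 1
  ext z
  have : ρ ^ n ≠ 0 := zpow_ne_zero _ hρ
  rw [mul_zpow, zpow_neg ρ, smul_eq_mul]
  field_simp

lemma laurentCoeff_sum_smul {ι : Type*} (s : Finset ι) {G : ι → ℂ → ℂ}
    (hG : ∀ i, ∀ z ≠ 0, DifferentiableAt ℂ (G i) z) (a : ι → ℂ) (n : ℤ) :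
    laurentCoeff (fun z => ∑ i ∈ s, a i * G i z) n = ∑ i ∈ s, a i * laurentCoeff (G i) n := by
  simp only [laurentCoeff]
  simp_rw [← smul_eq_mul (a _), ← Real.circleAverage_fun_smul]
  rw [← Real.circleAverage_fun_sum]
  · congr 1
    ext z
    rw [Finset.mul_sum]
    exact Finset.sum_congr rfl fun i _ => by simp only [smul_eq_mul]; ring
  · intro i _
    refine ContinuousOn.circleIntegrable' fun z hz => ContinuousAt.continuousWithinAt ?_
    have hz0 : z ≠ 0 := by rintro rfl; simp at hz
    exact ((differentiableAt_zpow_mul (hG i) (-n) hz0).const_smul (a i)).continuousAt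

lemma apply_one_eq_zero_of_laurentCoeff (hF : ∀ z ≠ 0, DifferentiableAt ℂ F z)
    (h : ∀ n, laurentCoeff F n = 0) : F 1 = 0 := by
  have : Fact (0 < 2 * Real.pi) := ⟨Real.two_pi_pos⟩
  let f : C(AddCircle (2 * Real.pi), ℂ) :=
    ⟨fun t => F (AddCircle.toCircle t), continuous_iff_continuousAt.2 fun t =>
      ContinuousAt.comp (f := fun t : AddCircle (2 * Real.pi) => (AddCircle.toCircle t : ℂ))
        (hF _ (by simp)).continuousAt
        (continuous_induced_dom.comp AddCircle.continuous_toCircle).continuousAt⟩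
  have hf : ∀ n, fourierCoeff f n = 0 := by
    intro n
    rw [fourierCoeff_eq_intervalIntegral f n 0, ← h n, laurentCoeff, Real.circleAverage_def,
      one_div, zero_add]
    congr 2
    ext θ
    have : (2 * Real.pi / (2 * Real.pi) : ℝ) = 1 := div_self Real.two_pi_pos.ne'
    simp only [fourier_apply, AddCircle.toCircle_zsmul, f, ContinuousMap.coe_mk,
      AddCircle.toCircle_apply_mk, this, one_mul, Circle.coe_zpow, Circle.coe_exp, circleMap,
      zero_add, ofReal_one, smul_eq_mul]
  have hs := has_pointwise_sum_fourier_series_of_summable (f := f)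
    (by simpa only [funext hf] using summable_zero) 0
  simp only [hf, zero_smul] at hs
  simpa [f] using hs.unique hasSum_zero

lemma eq_zero_of_laurentCoeff (hF : ∀ z ≠ 0, DifferentiableAt ℂ F z)
    (h : ∀ n, laurentCoeff F n = 0) {x : ℂ} (hx : x ≠ 0) : F x = 0 := by
  have := apply_one_eq_zero_of_laurentCoeff (F := fun z => F (x * z))
    (fun z hz => DifferentiableAt.fun_comp' z (hF _ (mul_ne_zero hx hz)) (by fun_prop))
    (fun n => by rw [laurentCoeff_comp_mul hF hx, h, mul_zero])
  simpa using this

end laurentCoeff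

/-- Theta functions of degree two: holomorphic on `ℂ \ {0}` with `F(qx) = c x⁻² F(x)`. -/
structure IsThetaTwo (q c : ℂ) (F : ℂ → ℂ) : Prop where
  differentiableAt : ∀ z ≠ 0, DifferentiableAt ℂ F z
  map_mul : ∀ z ≠ 0, F (q * z) = c / z ^ 2 * F z

namespace IsThetaTwo

variable {q c : ℂ} {F : ℂ → ℂ}

lemma sum_mul {ι : Type*} (s : Finset ι) {G : ι → ℂ → ℂ} (hG : ∀ i, IsThetaTwo q c (G i))
    (a : ι → ℂ) : IsThetaTwo q c (fun z => ∑ i ∈ s, a i * G i z) where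
  differentiableAt z hz := DifferentiableAt.fun_sum fun i _ =>
    ((hG i).differentiableAt z hz).const_mul (a i)
  map_mul z hz := by
    rw [Finset.mul_sum]
    exact Finset.sum_congr rfl fun i _ => by rw [(hG i).map_mul z hz]; ring

lemma laurentCoeff_add_two (hF : IsThetaTwo q c F) (hq : q ≠ 0) (n : ℤ) :
    q ^ n * laurentCoeff F n = c * laurentCoeff F (n + 2) := by
  rw [← laurentCoeff_comp_mul hF.differentiableAt hq, laurentCoeff, laurentCoeff,
    ← smul_eq_mul c, ← Real.circleAverage_fun_smul]
  refine Real.circleAverage_congr_sphere fun z hz => ?_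
  have hz0 : z ≠ 0 := by rintro rfl; simp at hz
  simp only [smul_eq_mul, hF.map_mul z hz0]
  rw [neg_add, zpow_add₀ hz0, zpow_neg z 2]
  norm_cast
  ring

lemma eq_zero (hF : IsThetaTwo q c F) (hq : q ≠ 0) (hc : c ≠ 0) (h0 : laurentCoeff F 0 = 0)
    (h1 : laurentCoeff F 1 = 0) {x : ℂ} (hx : x ≠ 0) : F x = 0 := by
  have step (n : ℤ) : laurentCoeff F n = 0 ↔ laurentCoeff F (n + 2) = 0 := by
    have := hF.laurentCoeff_add_two hq n
    have hqn : q ^ n ≠ 0 := zpow_ne_zero _ hq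
    constructor <;> intro h <;> simp_all
  have both (n : ℤ) : laurentCoeff F n = 0 ∧ laurentCoeff F (n + 1) = 0 := by
    induction n using Int.induction_on with
    | zero => exact ⟨h0, by simpa using h1⟩
    | succ n ih => exact ⟨ih.2, by simpa [add_assoc] using (step _).1 ih.1⟩
    | pred n ih => exact ⟨(step _).2 (by convert! ih.2 using 2; ring), by simpa using ih.1⟩
  exact eq_zero_of_laurentCoeff hF.differentiableAt (fun n => (both n).1) hx

/-- Any three theta functions of degree two with the same multiplier are linearly dependent. -/
lemma exists_relation {G : Fin 3 → ℂ → ℂ} (hG : ∀ i, IsThetaTwo q c (G i)) (hq : q ≠ 0)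
    (hc : c ≠ 0) : ∃ a : Fin 3 → ℂ, a ≠ 0 ∧ ∀ x ≠ 0, ∑ i, a i * G i x = 0 := by
  let L : (Fin 3 → ℂ) →ₗ[ℂ] (Fin 2 → ℂ) :=
    Matrix.mulVecLin (Matrix.of fun (j : Fin 2) (i : Fin 3) => laurentCoeff (G i) (j : ℕ))
  have hL : L.ker ≠ ⊥ := LinearMap.ker_ne_bot_of_finrank_lt (by simp)
  obtain ⟨a, ha, ha0⟩ := Submodule.exists_mem_ne_zero_of_ne_bot hL
  have hcoeff (j : Fin 2) : laurentCoeff (fun z => ∑ i, a i * G i z) (j : ℕ) = 0 := by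
    rw [laurentCoeff_sum_smul _ fun i => (hG i).differentiableAt]
    have := congrFun (LinearMap.mem_ker.1 ha) j
    simpa [L, Matrix.mulVec, dotProduct, mul_comm] using this
  exact ⟨a, ha0, fun x hx => (sum_mul Finset.univ hG a).eq_zero hq hc
    (by simpa using hcoeff 0) (by simpa using hcoeff 1) hx⟩

/-- A theta function of degree two vanishing at two points is zero, provided that each of these
points is separated from the other by some theta function with the same multiplier. -/
lemma eq_zero_of_two_zeros {G H : ℂ → ℂ} (hF : IsThetaTwo q c F) (hG : IsThetaTwo q c G)
    (hH : IsThetaTwo q c H) (hq : q ≠ 0) (hc : c ≠ 0) {u v : ℂ} (hu : u ≠ 0) (hv : v ≠ 0)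
    (hFu : F u = 0) (hFv : F v = 0) (hGu : G u ≠ 0) (hGv : G v = 0) (hHu : H u = 0)
    (hHv : H v ≠ 0) {x : ℂ} (hx : x ≠ 0) : F x = 0 := by
  obtain ⟨a, ha, hrel⟩ := exists_relation (G := ![F, G, H])
    (by intro i; fin_cases i <;> assumption) hq hc
  simp only [Fin.sum_univ_three, Matrix.cons_val] at hrel
  have h1 : a 1 = 0 := by simpa [hFu, hHu, hGu] using hrel u hu
  have h2 : a 2 = 0 := by simpa [hFv, hGv, hHv] using hrel v hv
  have h0 : a 0 ≠ 0 := fun h0 => ha (by ext i; fin_cases i <;> assumption)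
  simpa [h1, h2, h0] using hrel x hx

end IsThetaTwo

/-- Weierstrass' three-term relation for the multiplicative theta function. -/
lemma mulTheta_three_term {q : ℂ} (hq : ‖q‖ < 1) (hq0 : q ≠ 0) {p r b x : ℂ} (hp : p ≠ 0)
    (hr : r ≠ 0) (hb : b ≠ 0) (hx : x ≠ 0) (hTb : mulTheta q b ≠ 0)
    (hTpr : mulTheta q (p * r) ≠ 0) :
    mulTheta q (p * r / x) * mulTheta q (x * b) * (mulTheta q (r / b) * mulTheta q p)
      - x * mulTheta q (r / b / x) * mulTheta q (p / x) * (mulTheta q (p * r) * mulTheta q b)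
      - mulTheta q (p * r / b / x) * mulTheta q x * (mulTheta q (p * b) * mulTheta q r) = 0 := by
  have hpr : p * r ≠ 0 := mul_ne_zero hp hr
  have hprb : p * r / b ≠ 0 := div_ne_zero hpr hb
  have hrb : r / b ≠ 0 := div_ne_zero hr hb
  have h1 : IsThetaTwo q (p * r / (b * q)) fun x => mulTheta q (p * r / x) * mulTheta q (x * b) :=
    ⟨fun z hz => (differentiableAt_mulTheta_div hq hpr hz).mul
      (differentiableAt_mulTheta_mul hq hb hz), fun z hz => by
      rw [mulTheta_div_q_mul hq hq0 hpr hz, mul_assoc q,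
        mulTheta_q_mul hq hq0 (mul_ne_zero hz hb)]
      field_simp⟩
  have h2 : IsThetaTwo q (p * r / (b * q)) fun x =>
      x * mulTheta q (r / b / x) * mulTheta q (p / x) :=
    ⟨fun z hz => (differentiableAt_id.mul (differentiableAt_mulTheta_div hq hrb hz)).mul
      (differentiableAt_mulTheta_div hq hp hz), fun z hz => by
      rw [mulTheta_div_q_mul hq hq0 hrb hz, mulTheta_div_q_mul hq hq0 hp hz]
      field_simp⟩
  have h3 : IsThetaTwo q (p * r / (b * q)) fun x => mulTheta q (p * r / b / x) * mulTheta q x :=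
    ⟨fun z hz => (differentiableAt_mulTheta_div hq hprb hz).mul
      (differentiableAt_mulTheta hq hz), fun z hz => by
      rw [mulTheta_div_q_mul hq hq0 hprb hz, mulTheta_q_mul hq hq0 hz]
      field_simp⟩
  have hF : IsThetaTwo q (p * r / (b * q)) fun x =>
      mulTheta q (p * r / x) * mulTheta q (x * b) * (mulTheta q (r / b) * mulTheta q p)
      - x * mulTheta q (r / b / x) * mulTheta q (p / x) * (mulTheta q (p * r) * mulTheta q b)
      - mulTheta q (p * r / b / x) * mulTheta q x * (mulTheta q (p * b) * mulTheta q r) :=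
    ⟨fun z hz => (((h1.differentiableAt z hz).mul_const _).sub
      ((h2.differentiableAt z hz).mul_const _)).sub ((h3.differentiableAt z hz).mul_const _),
      fun z hz => by
      have e1 := h1.map_mul z hz
      have e2 := h2.map_mul z hz
      have e3 := h3.map_mul z hz
      rw [e1, e2, e3]
      ring⟩
  have hTb' : mulTheta q b⁻¹ ≠ 0 := by
    rw [mulTheta_inv hq hb]
    exact neg_ne_zero.2 (div_ne_zero hTb hb)
  refine hF.eq_zero_of_two_zeros h1 h3 hq0 (by positivity) one_ne_zero (inv_ne_zero hb)
    ?_ ?_ ?_ ?_ ?_ ?_ hx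
  · simp only [div_one, one_mul, mulTheta_one hq]
    ring
  · simp only [div_inv_eq_mul, inv_mul_cancel₀ hb, div_mul_cancel₀ _ hb, mulTheta_one hq,
      mulTheta_inv hq hb]
    field_simp
    ring
  · simpa using ⟨hTpr, hTb⟩
  · simp [inv_mul_cancel₀ hb, mulTheta_one hq]
  · simp [mulTheta_one hq]
  · simpa [div_mul_cancel₀ _ hb] using ⟨by simpa using hTpr, hTb'⟩

section theta

variable {τ : ℂ}

lemma norm_exp_two_pi_mul_I_lt_one (hτ : 0 < τ.im) :
    ‖Complex.exp (2 * (Real.pi : ℂ) * Complex.I * τ)‖ < 1 := by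
  simpa [Complex.norm_exp] using mul_pos Real.two_pi_pos hτ

lemma theta_eq_mulTheta (z τ : ℂ) :
    theta z τ = Complex.I * Complex.exp ((Real.pi : ℂ) * Complex.I * (τ / 4)) *
      qPoch (Complex.exp (2 * (Real.pi : ℂ) * Complex.I * τ))
        (Complex.exp (2 * (Real.pi : ℂ) * Complex.I * τ)) *
      (Complex.exp (-((Real.pi : ℂ) * Complex.I * z)) *
        mulTheta (Complex.exp (2 * (Real.pi : ℂ) * Complex.I * τ))
          (Complex.exp (2 * (Real.pi : ℂ) * Complex.I * z))) := by
  rw [theta, mulTheta, mul_sub, sub_eq_add_neg, Complex.exp_add]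
  ring

lemma exp_ne_exp_zpow {z : ℂ} (hz : z ∉ Lam τ) (n : ℤ) :
    Complex.exp (2 * (Real.pi : ℂ) * Complex.I * z) ≠
      Complex.exp (2 * (Real.pi : ℂ) * Complex.I * τ) ^ n := by
  rw [← Complex.exp_int_mul]
  intro h
  obtain ⟨m, hm⟩ := Complex.exp_eq_exp_iff_exists_int.1 h
  refine hz ⟨n, m, mul_left_cancel₀ Complex.two_pi_I_ne_zero ?_⟩
  rw [hm]
  ring

lemma mulTheta_exp_ne_zero (hτ : 0 < τ.im) {z : ℂ} (hz : z ∉ Lam τ) :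
    mulTheta (Complex.exp (2 * (Real.pi : ℂ) * Complex.I * τ))
      (Complex.exp (2 * (Real.pi : ℂ) * Complex.I * z)) ≠ 0 :=
  mulTheta_ne_zero (norm_exp_two_pi_mul_I_lt_one hτ) (Complex.exp_ne_zero _) (Complex.exp_ne_zero _)
    (exp_ne_exp_zpow hz)

lemma theta_ne_zero (hτ : 0 < τ.im) {z : ℂ} (hz : z ∉ Lam τ) : theta z τ ≠ 0 := by
  have hq := norm_exp_two_pi_mul_I_lt_one hτ
  rw [theta_eq_mulTheta]
  refine mul_ne_zero (mul_ne_zero (mul_ne_zero Complex.I_ne_zero (Complex.exp_ne_zero _))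
    (qPoch_ne_zero hq fun n hn => ?_))
    (mul_ne_zero (Complex.exp_ne_zero _) (mulTheta_exp_ne_zero hτ hz))
  rw [← pow_succ'] at hn
  have h := pow_lt_one₀ (norm_nonneg _) hq n.succ_ne_zero
  rw [← norm_pow, hn, norm_one] at h
  exact lt_irrefl _ h

lemma theta_neg (hτ : 0 < τ.im) (z : ℂ) : theta (-z) τ = -theta z τ := by
  have h : Complex.exp (2 * (Real.pi : ℂ) * Complex.I * z) =
      Complex.exp ((Real.pi : ℂ) * Complex.I * z) ^ 2 := by
    rw [← Complex.exp_nat_mul]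
    push_cast
    ring_nf
  rw [theta_eq_mulTheta, theta_eq_mulTheta, mul_neg, mul_neg, Complex.exp_neg (2 * _ * _ * _),
    mulTheta_inv (norm_exp_two_pi_mul_I_lt_one hτ) (Complex.exp_ne_zero _), neg_neg, Complex.exp_neg, h]
  field_simp

/-- Weierstrass' three-term relation for the Jacobi theta function. -/
lemma theta_three_term (hτ : 0 < τ.im) {v w a b : ℂ} (hb : b ∉ Lam τ) (hvw : v + w ∉ Lam τ) :
    theta (v + w - a) τ * theta (a + b) τ * (theta (w - b) τ * theta v τ)
      - theta (w - b - a) τ * theta (v - a) τ * (theta (v + w) τ * theta b τ)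
      - theta (v + w - b - a) τ * theta a τ * (theta (v + b) τ * theta w τ) = 0 := by
  have hTb := mulTheta_exp_ne_zero hτ hb
  have hTvw := mulTheta_exp_ne_zero hτ hvw
  rw [mul_add, Complex.exp_add] at hTvw
  have key := mulTheta_three_term (norm_exp_two_pi_mul_I_lt_one hτ) (Complex.exp_ne_zero _)
    (Complex.exp_ne_zero _) (Complex.exp_ne_zero _) (Complex.exp_ne_zero _)
    (Complex.exp_ne_zero (2 * (Real.pi : ℂ) * Complex.I * a)) hTb hTvw
  set e : ℂ → ℂ := fun z => Complex.exp (-((Real.pi : ℂ) * Complex.I * z)) with he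
  have e1 : e (v + w - a) * e (a + b) * (e (w - b) * e v) = e (2 * (v + w)) := by
    simp only [he, ← Complex.exp_add]
    ring_nf
  have e2 : e (w - b - a) * e (v - a) * (e (v + w) * e b) =
      e (2 * (v + w)) * Complex.exp (2 * (Real.pi : ℂ) * Complex.I * a) := by
    simp only [he, ← Complex.exp_add]
    ring_nf
  have e3 : e (v + w - b - a) * e a * (e (v + b) * e w) = e (2 * (v + w)) := by
    simp only [he, ← Complex.exp_add]
    ring_nf
  simp only [← Complex.exp_add, ← Complex.exp_sub, ← mul_add, ← mul_sub] at key e2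
  simp only [theta_eq_mulTheta]
  generalize Complex.I * Complex.exp ((Real.pi : ℂ) * Complex.I * (τ / 4)) *
      qPoch (Complex.exp (2 * (Real.pi : ℂ) * Complex.I * τ))
        (Complex.exp (2 * (Real.pi : ℂ) * Complex.I * τ)) = C
  generalize Complex.exp (2 * (Real.pi : ℂ) * Complex.I * τ) = q at key ⊢
  set T : ℂ → ℂ := fun z => mulTheta q (Complex.exp (2 * (Real.pi : ℂ) * Complex.I * z)) with hT
  change C * (e (v + w - a) * T (v + w - a)) * (C * (e (a + b) * T (a + b))) *
      (C * (e (w - b) * T (w - b)) * (C * (e v * T v)))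
    - C * (e (w - b - a) * T (w - b - a)) * (C * (e (v - a) * T (v - a))) *
      (C * (e (v + w) * T (v + w)) * (C * (e b * T b)))
    - C * (e (v + w - b - a) * T (v + w - b - a)) * (C * (e a * T a)) *
      (C * (e (v + b) * T (v + b)) * (C * (e w * T w))) = 0
  change T (v + w - a) * T (a + b) * (T (w - b) * T v)
    - Complex.exp (2 * (Real.pi : ℂ) * Complex.I * a) * T (w - b - a) * T (v - a) *
      (T (v + w) * T b)
    - T (v + w - b - a) * T a * (T (v + b) * T w) = 0 at key
  linear_combination C ^ 4 * e (2 * (v + w)) * key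
    + C ^ 4 * T (v + w - a) * T (a + b) * T (w - b) * T v * e1
    - C ^ 4 * T (w - b - a) * T (v - a) * T (v + w) * T b * e2
    - C ^ 4 * T (v + w - b - a) * T a * T (v + b) * T w * e3

end theta

/-- The three-term identity
`σ_{w₁+w₂}(t-u)σ_{w₂}(s-t) - σ_{w₂}(s-u)σ_{w₁}(t-u) + σ_{w₁}(t-s)σ_{w₁+w₂}(s-u) = 0`. -/
theorem sigma_three_term (τ : ℂ) (hτ : 0 < τ.im) (w₁ w₂ : ℂ)
    (hw₁ : w₁ ∉ Lam τ) (hw₂ : w₂ ∉ Lam τ) (hw₁₂ : w₁ + w₂ ∉ Lam τ)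
    (t s u : ℂ) (htu : t - u ∉ Lam τ) (hst : s - t ∉ Lam τ) (hsu : s - u ∉ Lam τ) :
    sigmaW (w₁ + w₂) (t - u) τ * sigmaW w₂ (s - t) τ
      - sigmaW w₂ (s - u) τ * sigmaW w₁ (t - u) τ
      + sigmaW w₁ (t - s) τ * sigmaW (w₁ + w₂) (s - u) τ = 0 := by
  have key := theta_three_term hτ (a := t - u) hst hw₁₂
  have h1 := theta_ne_zero hτ hw₁
  have h2 := theta_ne_zero hτ hw₂
  have h3 := theta_ne_zero hτ hw₁₂
  have h4 := theta_ne_zero hτ htu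
  have h5 := theta_ne_zero hτ hst
  have h6 := theta_ne_zero hτ hsu
  simp only [sigmaW]
  rw [← neg_sub s t, theta_neg hτ, sub_neg_eq_add]
  rw [show t - u + (s - t) = s - u by ring, show w₂ - (s - t) - (t - u) = w₂ - (s - u) by ring,
    show w₁ + w₂ - (s - t) - (t - u) = w₁ + w₂ - (s - u) by ring] at key
  field_simp
  linear_combination thetaD 0 τ ^ 2 * key
end
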